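/- (Coercivity of the twisted Grushin gradient.) Let 1 < p < Q and let α be a real number with α > (p−Q)/p. Then there exists a constant C' > 0 such that for every w ∈ C_0^∞(ℝ^{d+k}): ∫_{ℝ^{d+k}} |∇_μ w − α ρ^{−1} w ∇_μ ρ|^p dx dy ≥ C' ∫_{ℝ^{d+k}} |∇_μ w|^p dx dy, where ∇_μ ρ = (∇_x ρ, |x|^μ ∇_y ρ) is the Grushin gradient of ρ (defined for x ≠ 0; the integrand is understood almost everywhere, and |ρ^{−1} w ∇_μ ρ| = (|x|^μ/ρ^{μ+1}) |w|). -/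

import Mathlib

open MeasureTheory Real
open scoped RealInnerProductSpace ENNReal

/-- The anisotropic distance function `ρ(x,y) = (|x|^{2+2μ} + (1+μ)²|y|²)^{1/(2+2μ)}`. -/
noncomputable def grho (μ : ℝ) {d k : ℕ}
    (z : EuclideanSpace ℝ (Fin d) × EuclideanSpace ℝ (Fin k)) : ℝ :=
  (‖z.1‖ ^ (2 + 2 * μ) + (1 + μ) ^ 2 * ‖z.2‖ ^ 2) ^ (1 / (2 + 2 * μ))

/-- The Grushin gradient `∇_μ u = (∇_x u, |x|^μ ∇_y u)`. -/
noncomputable def gradMu (μ : ℝ) {d k : ℕ}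
    (u : EuclideanSpace ℝ (Fin d) × EuclideanSpace ℝ (Fin k) → ℝ)
    (z : EuclideanSpace ℝ (Fin d) × EuclideanSpace ℝ (Fin k)) :
    EuclideanSpace ℝ (Fin d) × EuclideanSpace ℝ (Fin k) :=
  (gradient (fun x => u (x, z.2)) z.1, (‖z.1‖ ^ μ) • gradient (fun y => u (z.1, y)) z.2)

/-- The Euclidean-type norm `((|v₁|² + |v₂|²))^{1/2}` of a pair. -/
noncomputable def pairNorm {d k : ℕ}
    (v : EuclideanSpace ℝ (Fin d) × EuclideanSpace ℝ (Fin k)) : ℝ :=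
  Real.sqrt (‖v.1‖ ^ 2 + ‖v.2‖ ^ 2)

/-- `|∇_μ u| = (|∇_x u|² + |x|^{2μ}|∇_y u|²)^{1/2}`. -/
noncomputable def gradMuNorm (μ : ℝ) {d k : ℕ}
    (u : EuclideanSpace ℝ (Fin d) × EuclideanSpace ℝ (Fin k) → ℝ)
    (z : EuclideanSpace ℝ (Fin d) × EuclideanSpace ℝ (Fin k)) : ℝ :=
  pairNorm (gradMu μ u z)

section Dilation

variable {d k : ℕ}

/-- The anisotropic dilation `(x, y) ↦ (eᵗ x, e^{(1+μ)t} y)`. -/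
noncomputable def grushinDilation (μ t : ℝ)
    (z : EuclideanSpace ℝ (Fin d) × EuclideanSpace ℝ (Fin k)) :
    EuclideanSpace ℝ (Fin d) × EuclideanSpace ℝ (Fin k) :=
  (exp t • z.1, exp ((1 + μ) * t) • z.2)

/-- The Hardy weight `|∇_μ ρ| / ρ = |x|^μ / ρ^{1+μ}`. -/
noncomputable def hardyWeight (μ : ℝ)
    (z : EuclideanSpace ℝ (Fin d) × EuclideanSpace ℝ (Fin k)) : ℝ :=
  ‖z.1‖ ^ μ / grho μ z ^ (1 + μ)

/-- The twisted Euler operator `x · ∂ₓ w + (1 + μ) y · ∂_y w - α w`. -/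
noncomputable def twistedEuler (μ α : ℝ)
    (w : EuclideanSpace ℝ (Fin d) × EuclideanSpace ℝ (Fin k) → ℝ)
    (z : EuclideanSpace ℝ (Fin d) × EuclideanSpace ℝ (Fin k)) : ℝ :=
  fderiv ℝ w z (z.1, (1 + μ) • z.2) - α * w z

lemma grho_nonneg (μ : ℝ) (z : EuclideanSpace ℝ (Fin d) × EuclideanSpace ℝ (Fin k)) :
    0 ≤ grho μ z := by
  unfold grho; positivity

lemma grho_base_pos (μ : ℝ) {z : EuclideanSpace ℝ (Fin d) × EuclideanSpace ℝ (Fin k)}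
    (hz : z.1 ≠ 0) : 0 < ‖z.1‖ ^ (2 + 2 * μ) + (1 + μ) ^ 2 * ‖z.2‖ ^ 2 := by
  have : 0 < ‖z.1‖ := norm_pos_iff.2 hz
  positivity

lemma grho_pos (μ : ℝ) {z : EuclideanSpace ℝ (Fin d) × EuclideanSpace ℝ (Fin k)}
    (hz : z.1 ≠ 0) : 0 < grho μ z :=
  rpow_pos_of_pos (grho_base_pos μ hz) _

lemma hardyWeight_nonneg (μ : ℝ) (z : EuclideanSpace ℝ (Fin d) × EuclideanSpace ℝ (Fin k)) :
    0 ≤ hardyWeight μ z := by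
  have := grho_nonneg μ z
  unfold hardyWeight; positivity

lemma hardyWeight_of_fst_eq_zero {μ : ℝ} (hμ : 0 < μ)
    {z : EuclideanSpace ℝ (Fin d) × EuclideanSpace ℝ (Fin k)} (hz : z.1 = 0) :
    hardyWeight μ z = 0 := by
  simp [hardyWeight, hz, zero_rpow hμ.ne']

lemma measurable_grho (μ : ℝ) : Measurable (grho μ (d := d) (k := k)) := by
  unfold grho; fun_prop

lemma measurable_hardyWeight (μ : ℝ) : Measurable (hardyWeight μ (d := d) (k := k)) := by
  have := measurable_grho μ (d := d) (k := k)
  unfold hardyWeight; fun_prop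

lemma grho_grushinDilation {μ : ℝ} (hμ : 0 < μ) (t : ℝ)
    (z : EuclideanSpace ℝ (Fin d) × EuclideanSpace ℝ (Fin k)) :
    grho μ (grushinDilation μ t z) = exp t * grho μ z := by
  have h : ‖(grushinDilation μ t z).1‖ ^ (2 + 2 * μ)
      + (1 + μ) ^ 2 * ‖(grushinDilation μ t z).2‖ ^ 2
      = exp (t * (2 + 2 * μ)) * (‖z.1‖ ^ (2 + 2 * μ) + (1 + μ) ^ 2 * ‖z.2‖ ^ 2) := by
    simp only [grushinDilation, norm_smul, norm_eq_abs, abs_exp]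
    rw [mul_rpow (exp_pos _).le (norm_nonneg _), ← exp_mul, mul_pow, ← exp_nat_mul]
    push_cast
    rw [show 2 * ((1 + μ) * t) = t * (2 + 2 * μ) by ring]
    ring
  have h2 : (2 + 2 * μ) ≠ 0 := by positivity
  unfold grho
  rw [h, mul_rpow (exp_pos _).le (by positivity), ← exp_mul]
  congr 2
  field_simp

lemma hardyWeight_grushinDilation {μ : ℝ} (hμ : 0 < μ) (t : ℝ)
    (z : EuclideanSpace ℝ (Fin d) × EuclideanSpace ℝ (Fin k)) :
    hardyWeight μ (grushinDilation μ t z) = exp (-t) * hardyWeight μ z := by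
  unfold hardyWeight
  rw [grho_grushinDilation hμ]
  simp only [grushinDilation, norm_smul, norm_eq_abs, abs_exp]
  rw [mul_rpow (exp_pos _).le (norm_nonneg _), mul_rpow (exp_pos _).le (grho_nonneg _ _),
    mul_div_mul_comm, ← exp_mul, ← exp_mul, ← exp_sub]
  congr 2
  ring

lemma continuous_grushinDilation (μ : ℝ) : Continuous fun q :
    ℝ × (EuclideanSpace ℝ (Fin d) × EuclideanSpace ℝ (Fin k)) => grushinDilation μ q.1 q.2 := by
  unfold grushinDilation; fun_prop

lemma measurable_comp_grushinDilation (μ : ℝ) {β : Type*} [MeasurableSpace β] {f :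
    EuclideanSpace ℝ (Fin d) × EuclideanSpace ℝ (Fin k) → β} (hf : Measurable f) : Measurable fun q :
    (EuclideanSpace ℝ (Fin d) × EuclideanSpace ℝ (Fin k)) × ℝ => f (grushinDilation μ q.2 q.1) := by
  refine hf.comp ?_
  unfold grushinDilation
  fun_prop

lemma lintegral_comp_grushinDilation (μ t : ℝ)
    {f : EuclideanSpace ℝ (Fin d) × EuclideanSpace ℝ (Fin k) → ℝ≥0∞} (hf : Measurable f) :
    ∫⁻ z, f (grushinDilation μ t z)
      = ENNReal.ofReal (exp (-(d + (1 + μ) * k) * t)) * ∫⁻ z, f z := by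
  have hδ : Measurable (grushinDilation μ t (d := d) (k := k)) := by
    unfold grushinDilation; fun_prop
  have hmap : Measure.map (grushinDilation μ t (d := d) (k := k)) volume
      = ENNReal.ofReal (exp (-(d + (1 + μ) * k) * t)) • volume := by
    have h := Measure.map_prod_map
      (volume : Measure (EuclideanSpace ℝ (Fin d))) (volume : Measure (EuclideanSpace ℝ (Fin k)))
      (f := fun x => exp t • x) (g := fun y => exp ((1 + μ) * t) • y)
      (by fun_prop) (by fun_prop)
    rw [Measure.volume_eq_prod]
    refine Eq.trans h.symm ?_
    rw [Measure.map_addHaar_smul _ (exp_pos _).ne', Measure.map_addHaar_smul _ (exp_pos _).ne',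
      Measure.prod_smul_left, Measure.prod_smul_right, smul_smul,
      ← ENNReal.ofReal_mul (abs_nonneg _)]
    congr 2
    rw [finrank_euclideanSpace_fin, finrank_euclideanSpace_fin, ← exp_nat_mul, ← exp_nat_mul,
      ← exp_neg, ← exp_neg, abs_exp, abs_exp, ← exp_add]
    congr 1
    ring
  rw [← lintegral_map hf hδ, hmap, lintegral_smul_measure, smul_eq_mul]

lemma continuous_twistedEuler (μ α : ℝ)
    {w : EuclideanSpace ℝ (Fin d) × EuclideanSpace ℝ (Fin k) → ℝ} (hw : ContDiff ℝ 1 w) :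
    Continuous (twistedEuler μ α w) := by
  have h1 := hw.continuous
  have h2 := hw.continuous_fderiv (by simp)
  have h3 : Continuous fun z : EuclideanSpace ℝ (Fin d) × EuclideanSpace ℝ (Fin k) =>
      (z.1, (1 + μ) • z.2) := by fun_prop
  exact (h2.clm_apply h3).sub (continuous_const.mul h1)

lemma hasDerivAt_exp_mul_comp_grushinDilation (μ α : ℝ)
    {w : EuclideanSpace ℝ (Fin d) × EuclideanSpace ℝ (Fin k) → ℝ} (hw : ContDiff ℝ 1 w)
    (z : EuclideanSpace ℝ (Fin d) × EuclideanSpace ℝ (Fin k)) (t : ℝ) :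
    HasDerivAt (fun t => exp (-α * t) * w (grushinDilation μ t z))
      (exp (-α * t) * twistedEuler μ α w (grushinDilation μ t z)) t := by
  have h1 : HasDerivAt (fun t => exp t • z.1) (exp t • z.1) t :=
    (Real.hasDerivAt_exp t).smul_const _
  have he : ∀ c : ℝ, HasDerivAt (fun t => exp (c * t)) (exp (c * t) * c) t := fun c => by
    simpa using ((hasDerivAt_id t).const_mul c).exp
  have h2 : HasDerivAt (fun t => exp ((1 + μ) * t) • z.2)
      ((1 + μ) • exp ((1 + μ) * t) • z.2) t := by
    simpa [smul_smul, mul_comm] using (he (1 + μ)).smul_const z.2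
  have h3 : HasDerivAt (fun t => grushinDilation μ t z)
      ((grushinDilation μ t z).1, (1 + μ) • (grushinDilation μ t z).2) t := h1.prodMk h2
  have h4 := ((hw.differentiable (by simp)) (grushinDilation μ t z)).hasFDerivAt.comp_hasDerivAt t h3
  refine ((he (-α)).mul h4).congr_deriv ?_
  simp only [twistedEuler, Function.comp_apply]
  ring

lemma enorm_le_lintegral_twistedEuler (μ α : ℝ)
    {w : EuclideanSpace ℝ (Fin d) × EuclideanSpace ℝ (Fin k) → ℝ} (hw : ContDiff ℝ 1 w)
    (hc : HasCompactSupport w)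
    {z : EuclideanSpace ℝ (Fin d) × EuclideanSpace ℝ (Fin k)} (hz : z.1 ≠ 0) :
    ‖w z‖ₑ ≤ ∫⁻ t in Set.Ioi (0 : ℝ),
      ENNReal.ofReal (exp (-α * t)) * ‖twistedEuler μ α w (grushinDilation μ t z)‖ₑ := by
  obtain ⟨T, hT0, hT⟩ : ∃ T : ℝ, 0 ≤ T ∧ w (grushinDilation μ T z) = 0 := by
    obtain ⟨R, hR⟩ := hc.isCompact.isBounded.exists_norm_le
    have hlim : Filter.Tendsto (fun t : ℝ => exp t * ‖z.1‖) Filter.atTop Filter.atTop :=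
      tendsto_exp_atTop.atTop_mul_const (norm_pos_iff.2 hz)
    obtain ⟨T, hT, hT0⟩ := ((hlim.eventually_gt_atTop R).and (Filter.eventually_ge_atTop 0)).exists
    refine ⟨T, hT0, image_eq_zero_of_notMem_tsupport fun hmem => ?_⟩
    have h1 := (norm_fst_le _).trans (hR _ hmem)
    simp only [grushinDilation, norm_smul, norm_eq_abs, abs_exp] at h1
    exact absurd hT h1.not_gt
  have hcont : Continuous fun t => exp (-α * t) * twistedEuler μ α w (grushinDilation μ t z) := by
    have := (continuous_twistedEuler μ α hw).comp
      ((continuous_grushinDilation μ).comp (Continuous.prodMk_left z))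
    exact (by fun_prop : Continuous fun t : ℝ => exp (-α * t)).mul this
  have hftc := intervalIntegral.integral_eq_sub_of_hasDerivAt
    (fun t _ => hasDerivAt_exp_mul_comp_grushinDilation μ α hw z t)
    (hcont.intervalIntegrable 0 T)
  have h0 : grushinDilation μ 0 z = z := by simp [grushinDilation]
  rw [hT, h0, intervalIntegral.integral_of_le hT0] at hftc
  have hwz : ‖w z‖ₑ = ‖∫ t in Set.Ioc 0 T,
      exp (-α * t) * twistedEuler μ α w (grushinDilation μ t z)‖ₑ := by
    rw [hftc]; simp
  rw [hwz]
  refine (enorm_integral_le_lintegral_enorm _).trans ?_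
  refine (lintegral_mono_set Set.Ioc_subset_Ioi_self).trans (le_of_eq ?_)
  refine lintegral_congr fun t => ?_
  rw [enorm_mul, enorm_of_nonneg (exp_pos _).le]

end Dilation

section HardyInequality

lemma lintegral_exp_mul_Ioi_lt_top {a : ℝ} (ha : a < 0) :
    ∫⁻ t in Set.Ioi (0 : ℝ), ENNReal.ofReal (exp (a * t)) < ∞ :=
  (integrableOn_exp_mul_Ioi ha 0).lintegral_lt_top

lemma rpow_lintegral_Ioi_le {p q : ℝ} (hpq : p.HolderConjugate q) (ε : ℝ)
    {h : ℝ → ℝ≥0∞} (hh : Measurable h) :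
    (∫⁻ t in Set.Ioi (0 : ℝ), h t) ^ p
      ≤ (∫⁻ t in Set.Ioi (0 : ℝ), ENNReal.ofReal (exp (-(ε * q) * t))) ^ (p / q)
        * ∫⁻ t in Set.Ioi (0 : ℝ), ENNReal.ofReal (exp (p * ε * t)) * h t ^ p := by
  have hp := hpq.pos
  have hH := ENNReal.lintegral_mul_le_Lp_mul_Lq (volume.restrict (Set.Ioi (0 : ℝ))) hpq.symm
    (f := fun t => ENNReal.ofReal (exp (-ε * t)))
    (g := fun t => ENNReal.ofReal (exp (ε * t)) * h t) (by fun_prop) (by fun_prop)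
  have e1 : ∀ t, ((fun t => ENNReal.ofReal (exp (-ε * t)))
      * fun t => ENNReal.ofReal (exp (ε * t)) * h t) t = h t := fun t => by
    simp only [Pi.mul_apply]
    rw [← mul_assoc, ← ENNReal.ofReal_mul (exp_pos _).le, ← exp_add]
    simp
  have e2 : ∀ t, ENNReal.ofReal (exp (-ε * t)) ^ q = ENNReal.ofReal (exp (-(ε * q) * t)) :=
    fun t => by
      rw [ENNReal.ofReal_rpow_of_pos (exp_pos _), ← exp_mul]
      ring_nf
  have e3 : ∀ t, (ENNReal.ofReal (exp (ε * t)) * h t) ^ p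
      = ENNReal.ofReal (exp (p * ε * t)) * h t ^ p := fun t => by
    rw [ENNReal.mul_rpow_of_nonneg _ _ hp.le, ENNReal.ofReal_rpow_of_pos (exp_pos _), ← exp_mul]
    ring_nf
  simp only [e1, e2, e3] at hH
  refine (ENNReal.rpow_le_rpow hH hp.le).trans (le_of_eq ?_)
  rw [ENNReal.mul_rpow_of_nonneg _ _ hp.le, ← ENNReal.rpow_mul, ← ENNReal.rpow_mul,
    one_div_mul_cancel hp.ne', ENNReal.rpow_one]
  congr 2
  ring

/-- Weighted Hardy inequality for the twisted Euler operator. -/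
lemma exists_lintegral_hardyWeight_le (d k : ℕ) {μ : ℝ} (hμ : 0 < μ) {p α : ℝ} (hp : 1 < p)
    (hα : (p - (d + (1 + μ) * k)) / p < α) :
    ∃ K : ℝ≥0∞, K ≠ ∞ ∧
      ∀ w : EuclideanSpace ℝ (Fin d) × EuclideanSpace ℝ (Fin k) → ℝ,
        ContDiff ℝ 1 w → HasCompactSupport w →
        ∫⁻ z, (ENNReal.ofReal (hardyWeight μ z) * ‖w z‖ₑ) ^ p
          ≤ K * ∫⁻ z, (ENNReal.ofReal (hardyWeight μ z) * ‖twistedEuler μ α w z‖ₑ) ^ p := by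
  have hp0 : 0 < p := by linarith
  obtain ⟨q, hpq⟩ : ∃ q, p.HolderConjugate q := ⟨_, Real.HolderConjugate.conjExponent hp⟩
  set Q : ℝ := d + (1 + μ) * k with hQ
  set ε : ℝ := ((Q - p) / p + α) / 2 with hε
  have hε0 : 0 < ε := by
    have : (Q - p) / p = -((p - Q) / p) := by ring
    rw [hε, this]; linarith
  set K₁ := (∫⁻ t in Set.Ioi (0 : ℝ), ENNReal.ofReal (exp (-(ε * q) * t))) ^ (p / q) with hK₁
  set K₂ := ∫⁻ t in Set.Ioi (0 : ℝ), ENNReal.ofReal (exp (-(p * ε) * t)) with hK₂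
  have hK₁' : K₁ ≠ ∞ := by
    refine (ENNReal.rpow_lt_top_of_nonneg (div_nonneg hp0.le hpq.symm.pos.le) ?_).ne
    exact (lintegral_exp_mul_Ioi_lt_top (by have := hpq.symm.pos; nlinarith [mul_pos hε0 this])).ne
  have hK₂' : K₂ ≠ ∞ := (lintegral_exp_mul_Ioi_lt_top (by nlinarith [mul_pos hp0 hε0])).ne
  refine ⟨K₁ * K₂, ENNReal.mul_ne_top hK₁' hK₂', fun w hw hc => ?_⟩
  have hw' := fun z hz => enorm_le_lintegral_twistedEuler μ α hw hc (z := z) hz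
  have hgm : Measurable (twistedEuler μ α w) := (continuous_twistedEuler μ α hw).measurable
  generalize twistedEuler μ α w = g at hw' hgm ⊢
  have hθ := measurable_hardyWeight μ (d := d) (k := k)
  obtain ⟨M, hM⟩ : ∃ M : EuclideanSpace ℝ (Fin d) × EuclideanSpace ℝ (Fin k) → ℝ≥0∞,
    M = fun z => (ENNReal.ofReal (hardyWeight μ z) * ‖g z‖ₑ) ^ p := ⟨_, rfl⟩
  have hMm : Measurable M := by rw [hM]; fun_prop
  have hMδ := measurable_comp_grushinDilation μ hMm
  have hΦ : Measurable fun q : (EuclideanSpace ℝ (Fin d) × EuclideanSpace ℝ (Fin k)) × ℝ =>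
      ENNReal.ofReal (exp (p * (ε - α + 1) * q.2)) * M (grushinDilation μ q.2 q.1) :=
    Measurable.mul (by fun_prop) hMδ
  have hpoint : ∀ z, (ENNReal.ofReal (hardyWeight μ z) * ‖w z‖ₑ) ^ p
      ≤ K₁ * ∫⁻ t in Set.Ioi (0 : ℝ),
        ENNReal.ofReal (exp (p * (ε - α + 1) * t)) * M (grushinDilation μ t z) := by
    intro z
    by_cases hz : z.1 = 0
    · simp [hardyWeight_of_fst_eq_zero hμ hz, ENNReal.zero_rpow_of_pos hp0]
    have hgz : Measurable fun t => g (grushinDilation μ t z) :=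
      (measurable_comp_grushinDilation μ hgm).comp measurable_prodMk_left
    have hu : Measurable fun t => ENNReal.ofReal (exp (-α * t)) * ‖g (grushinDilation μ t z)‖ₑ :=
      Measurable.mul (by fun_prop) hgz.enorm
    have h1 := (ENNReal.rpow_le_rpow (hw' z hz) hp0.le).trans (rpow_lintegral_Ioi_le hpq ε hu)
    rw [ENNReal.mul_rpow_of_nonneg _ _ hp0.le]
    refine (mul_le_mul_right h1 _).trans (le_of_eq ?_)
    have hv : Measurable fun t => ENNReal.ofReal (exp (p * ε * t))
        * (ENNReal.ofReal (exp (-α * t)) * ‖g (grushinDilation μ t z)‖ₑ) ^ p :=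
      Measurable.mul (by fun_prop) (hu.pow_const p)
    rw [mul_left_comm, ← lintegral_const_mul _ hv]
    congr 1
    refine lintegral_congr fun t => ?_
    rw [hM]
    simp only
    rw [hardyWeight_grushinDilation hμ, ENNReal.ofReal_mul (exp_pos _).le]
    simp only [ENNReal.mul_rpow_of_nonneg _ _ hp0.le, ENNReal.ofReal_rpow_of_pos (exp_pos _),
      ← exp_mul]
    have hexp : ENNReal.ofReal (exp (p * (ε - α + 1) * t)) * ENNReal.ofReal (exp (-t * p))
        = ENNReal.ofReal (exp (p * ε * t)) * ENNReal.ofReal (exp (-α * t * p)) := by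
      rw [← ENNReal.ofReal_mul (exp_pos _).le, ← ENNReal.ofReal_mul (exp_pos _).le, ← exp_add,
        ← exp_add]
      ring_nf
    simp only [← mul_assoc, hexp]
    ring
  calc ∫⁻ z, (ENNReal.ofReal (hardyWeight μ z) * ‖w z‖ₑ) ^ p
      ≤ ∫⁻ z, K₁ * ∫⁻ t in Set.Ioi (0 : ℝ),
          ENNReal.ofReal (exp (p * (ε - α + 1) * t)) * M (grushinDilation μ t z) :=
        lintegral_mono hpoint
    _ = K₁ * ∫⁻ t in Set.Ioi (0 : ℝ), ∫⁻ z,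
          ENNReal.ofReal (exp (p * (ε - α + 1) * t)) * M (grushinDilation μ t z) := by
        rw [lintegral_const_mul _ hΦ.lintegral_prod_right', lintegral_lintegral_swap hΦ.aemeasurable]
    _ = K₁ * ∫⁻ t in Set.Ioi (0 : ℝ), ENNReal.ofReal (exp (-(p * ε) * t)) * ∫⁻ z, M z := by
        congr 1
        refine lintegral_congr fun t => ?_
        have hMt : Measurable fun z => M (grushinDilation μ t z) := hMδ.comp measurable_prodMk_right
        rw [lintegral_const_mul _ hMt, lintegral_comp_grushinDilation μ t hMm, ← mul_assoc,
          ← ENNReal.ofReal_mul (exp_pos _).le, ← exp_add]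
        congr 3
        rw [← hQ, hε]
        field_simp
        ring
    _ = K₁ * K₂ * ∫⁻ z, (ENNReal.ofReal (hardyWeight μ z) * ‖g z‖ₑ) ^ p := by
        rw [lintegral_mul_const _ (by fun_prop), mul_assoc, hM]

end HardyInequality

section GrushinGradient

variable {d k : ℕ}

lemma pairNorm_eq_norm_toLp (v : EuclideanSpace ℝ (Fin d) × EuclideanSpace ℝ (Fin k)) :
    pairNorm v = ‖WithLp.toLp 2 v‖ := by
  rw [WithLp.prod_norm_eq_of_L2]; rfl

lemma pairNorm_nonneg (v : EuclideanSpace ℝ (Fin d) × EuclideanSpace ℝ (Fin k)) :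
    0 ≤ pairNorm v := Real.sqrt_nonneg _

lemma pairNorm_smul (c : ℝ) (v : EuclideanSpace ℝ (Fin d) × EuclideanSpace ℝ (Fin k)) :
    pairNorm (c • v) = |c| * pairNorm v := by
  simp only [pairNorm_eq_norm_toLp, WithLp.toLp_smul, norm_smul, norm_eq_abs]

lemma pairNorm_sub_le (u v : EuclideanSpace ℝ (Fin d) × EuclideanSpace ℝ (Fin k)) :
    pairNorm (u - v) ≤ pairNorm u + pairNorm v := by
  simp only [pairNorm_eq_norm_toLp, WithLp.toLp_sub]
  exact norm_sub_le _ _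

lemma pairNorm_le_pairNorm_sub_add
    (u v : EuclideanSpace ℝ (Fin d) × EuclideanSpace ℝ (Fin k)) :
    pairNorm u ≤ pairNorm (u - v) + pairNorm v := by
  simp only [pairNorm_eq_norm_toLp, WithLp.toLp_sub]
  exact norm_le_norm_sub_add _ _

lemma abs_inner_add_inner_le_pairNorm_mul
    (u v : EuclideanSpace ℝ (Fin d) × EuclideanSpace ℝ (Fin k)) :
    |⟪u.1, v.1⟫ + ⟪u.2, v.2⟫| ≤ pairNorm u * pairNorm v := by
  simp only [pairNorm_eq_norm_toLp]
  exact abs_real_inner_le_norm (WithLp.toLp 2 u) (WithLp.toLp 2 v)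

lemma continuous_pairNorm : Continuous (pairNorm (d := d) (k := k)) := by
  unfold pairNorm; fun_prop

/-- The explicit Grushin gradient of `ρ` away from `x = 0`. -/
noncomputable def gradMuGrho (μ : ℝ)
    (z : EuclideanSpace ℝ (Fin d) × EuclideanSpace ℝ (Fin k)) :
    EuclideanSpace ℝ (Fin d) × EuclideanSpace ℝ (Fin k) :=
  (((‖z.1‖ ^ μ) ^ 2 / (grho μ z * (grho μ z ^ μ) ^ 2)) • z.1,
    ((1 + μ) * ‖z.1‖ ^ μ / (grho μ z * (grho μ z ^ μ) ^ 2)) • z.2)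

lemma measurable_gradMuGrho (μ : ℝ) : Measurable (gradMuGrho μ (d := d) (k := k)) := by
  have := measurable_grho μ (d := d) (k := k)
  unfold gradMuGrho; fun_prop

lemma rpow_two_add_two_mul {r : ℝ} (hr : 0 < r) (μ : ℝ) :
    r ^ (2 + 2 * μ) = r ^ 2 * (r ^ μ) ^ 2 := by
  rw [rpow_add hr, mul_comm 2 μ, rpow_mul hr.le]
  norm_cast

lemma grho_sq_mul_sq {μ : ℝ} (hμ : 0 < μ)
    {z : EuclideanSpace ℝ (Fin d) × EuclideanSpace ℝ (Fin k)} (hz : z.1 ≠ 0) :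
    grho μ z ^ 2 * (grho μ z ^ μ) ^ 2
      = ‖z.1‖ ^ 2 * (‖z.1‖ ^ μ) ^ 2 + (1 + μ) ^ 2 * ‖z.2‖ ^ 2 := by
  rw [← rpow_two_add_two_mul (grho_pos μ hz), ← rpow_two_add_two_mul (norm_pos_iff.2 hz), grho,
    ← rpow_mul (grho_base_pos μ hz).le, one_div_mul_cancel (by positivity), rpow_one]

lemma hardyWeight_eq (μ : ℝ)
    {z : EuclideanSpace ℝ (Fin d) × EuclideanSpace ℝ (Fin k)} (hz : z.1 ≠ 0) :
    hardyWeight μ z = ‖z.1‖ ^ μ / (grho μ z * grho μ z ^ μ) := by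
  rw [hardyWeight, rpow_add (grho_pos μ hz), rpow_one]

lemma gradMu_grho {μ : ℝ} (hμ : 0 < μ)
    {z : EuclideanSpace ℝ (Fin d) × EuclideanSpace ℝ (Fin k)} (hz : z.1 ≠ 0) :
    gradMu μ (grho μ) z = gradMuGrho μ z := by
  have hB := grho_base_pos μ hz
  have hρ := grho_pos μ hz
  have hn := norm_pos_iff.2 hz
  have hpow : (‖z.1‖ ^ (2 + 2 * μ) + (1 + μ) ^ 2 * ‖z.2‖ ^ 2) ^ (1 / (2 + 2 * μ) - 1)
      = 1 / (grho μ z * (grho μ z ^ μ) ^ 2) := by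
    have h1 := grho_sq_mul_sq hμ hz
    rw [rpow_sub_one hB.ne', ← grho, rpow_two_add_two_mul hn, ← h1]
    field_simp
  have hx : HasGradientAt (fun x => grho μ (x, z.2)) (gradMuGrho μ z).1 z.1 := by
    rw [hasGradientAt_iff_hasFDerivAt]
    have h1 := ((hasFDerivAt_norm_rpow z.1 (by linarith : 1 < 2 + 2 * μ)).add_const
      ((1 + μ) ^ 2 * ‖z.2‖ ^ 2)).rpow_const (p := 1 / (2 + 2 * μ)) (Or.inl hB.ne')
    refine h1.congr_fderiv ?_
    rw [hpow, show 2 + 2 * μ - 2 = μ * 2 by ring, rpow_mul hn.le, rpow_two]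
    ext v
    simp only [gradMuGrho, map_smul, smul_apply, innerSL_apply_apply,
      InnerProductSpace.toDual_apply_apply, smul_eq_mul]
    field_simp
  have hy : HasGradientAt (fun y => grho μ (z.1, y))
      (((1 + μ) / (grho μ z * (grho μ z ^ μ) ^ 2)) • z.2) z.2 := by
    rw [hasGradientAt_iff_hasFDerivAt]
    have h1 := (((hasStrictFDerivAt_norm_sq z.2).hasFDerivAt.const_mul ((1 + μ) ^ 2)).const_add
      (‖z.1‖ ^ (2 + 2 * μ))).rpow_const (p := 1 / (2 + 2 * μ)) (Or.inl hB.ne')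
    refine h1.congr_fderiv ?_
    rw [hpow]
    ext v
    simp only [map_smul, smul_apply, innerSL_apply_apply,
      InnerProductSpace.toDual_apply_apply, smul_eq_mul, nsmul_eq_mul]
    field_simp
    push_cast
    ring
  unfold gradMu
  rw [hx.gradient, hy.gradient, smul_smul]
  refine Prod.ext rfl ?_
  simp only [gradMuGrho]
  congr 1
  ring

lemma pairNorm_gradMuGrho {μ : ℝ} (hμ : 0 < μ)
    {z : EuclideanSpace ℝ (Fin d) × EuclideanSpace ℝ (Fin k)} (hz : z.1 ≠ 0) :
    pairNorm (gradMuGrho μ z) = hardyWeight μ z * grho μ z := by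
  have hρ := grho_pos μ hz
  have hn := norm_pos_iff.2 hz
  have h1 := grho_sq_mul_sq hμ hz
  rw [hardyWeight_eq μ hz, pairNorm, Real.sqrt_eq_iff_mul_self_eq (by positivity) (by positivity)]
  simp only [gradMuGrho, norm_smul, mul_pow, norm_eq_abs, sq_abs]
  have hm : 0 < ‖z.1‖ ^ μ := rpow_pos_of_pos hn _
  have hnn : 0 < grho μ z ^ μ := rpow_pos_of_pos hρ _
  generalize ‖z.1‖ ^ μ = m at *
  generalize grho μ z ^ μ = n at *
  field_simp
  linear_combination -h1

lemma pairNorm_smul_gradMuGrho {μ : ℝ} (hμ : 0 < μ) (α c : ℝ)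
    {z : EuclideanSpace ℝ (Fin d) × EuclideanSpace ℝ (Fin k)} (hz : z.1 ≠ 0) :
    pairNorm ((α * c / grho μ z) • gradMuGrho μ z) = |α| * (hardyWeight μ z * |c|) := by
  have hρ := grho_pos μ hz
  rw [pairNorm_smul, pairNorm_gradMuGrho hμ hz, abs_div, abs_mul, abs_of_pos hρ]
  field_simp

lemma gradMu_eq_of_differentiableAt (μ : ℝ)
    {w : EuclideanSpace ℝ (Fin d) × EuclideanSpace ℝ (Fin k) → ℝ}
    {z : EuclideanSpace ℝ (Fin d) × EuclideanSpace ℝ (Fin k)} (hw : DifferentiableAt ℝ w z) :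
    gradMu μ w z
      = ((InnerProductSpace.toDual ℝ _).symm
          ((fderiv ℝ w z).comp (ContinuousLinearMap.inl ℝ _ _)),
        (‖z.1‖ ^ μ) • (InnerProductSpace.toDual ℝ _).symm
          ((fderiv ℝ w z).comp (ContinuousLinearMap.inr ℝ _ _))) := by
  have h1 : HasFDerivAt (fun x => w (x, z.2))
      ((fderiv ℝ w z).comp (ContinuousLinearMap.inl ℝ _ _)) z.1 :=
    HasFDerivAt.comp z.1 (g := w) hw.hasFDerivAt (hasFDerivAt_prodMk_left z.1 z.2)
  have h2 : HasFDerivAt (fun y => w (z.1, y))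
      ((fderiv ℝ w z).comp (ContinuousLinearMap.inr ℝ _ _)) z.2 :=
    HasFDerivAt.comp z.2 (g := w) hw.hasFDerivAt (hasFDerivAt_prodMk_right z.1 z.2)
  rw [gradMu, gradient, gradient, h1.fderiv, h2.fderiv]

lemma continuous_gradMu {μ : ℝ} (hμ : 0 < μ)
    {w : EuclideanSpace ℝ (Fin d) × EuclideanSpace ℝ (Fin k) → ℝ} (hw : ContDiff ℝ 1 w) :
    Continuous (gradMu μ w) := by
  have h := hw.continuous_fderiv (by simp)
  have hn : Continuous fun z : EuclideanSpace ℝ (Fin d) × EuclideanSpace ℝ (Fin k) =>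
      ‖z.1‖ ^ μ := continuous_fst.norm.rpow_const fun _ => Or.inr hμ.le
  refine Continuous.congr (Continuous.prodMk ?_ (hn.smul ?_)) fun z =>
    (gradMu_eq_of_differentiableAt μ (hw.differentiable (by simp) z)).symm
  · exact (LinearIsometryEquiv.continuous _).comp (h.clm_comp continuous_const)
  · exact (LinearIsometryEquiv.continuous _).comp (h.clm_comp continuous_const)

lemma gradMu_eq_zero_of_notMem_tsupport (μ : ℝ)
    {w : EuclideanSpace ℝ (Fin d) × EuclideanSpace ℝ (Fin k) → ℝ} (hw : ContDiff ℝ 1 w)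
    {z : EuclideanSpace ℝ (Fin d) × EuclideanSpace ℝ (Fin k)} (hz : z ∉ tsupport w) :
    gradMu μ w z = 0 := by
  rw [gradMu_eq_of_differentiableAt μ (hw.differentiable (by simp) z),
    fderiv_of_notMem_tsupport (𝕜 := ℝ) hz]
  simp

lemma integrable_gradMuNorm_rpow {μ : ℝ} (hμ : 0 < μ) {p : ℝ} (hp : 0 < p)
    {w : EuclideanSpace ℝ (Fin d) × EuclideanSpace ℝ (Fin k) → ℝ} (hw : ContDiff ℝ 1 w)
    (hc : HasCompactSupport w) : Integrable fun z => gradMuNorm μ w z ^ p := by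
  refine Continuous.integrable_of_hasCompactSupport ?_ ?_
  · exact (continuous_pairNorm.comp (continuous_gradMu hμ hw)).rpow_const fun _ => Or.inr hp.le
  · refine HasCompactSupport.intro hc.isCompact fun z hz => ?_
    simp [gradMuNorm, gradMu_eq_zero_of_notMem_tsupport μ hw hz, pairNorm, zero_rpow hp.ne']

lemma hardyWeight_mul_abs_twistedEuler_le {μ : ℝ} (hμ : 0 < μ) (α : ℝ)
    {w : EuclideanSpace ℝ (Fin d) × EuclideanSpace ℝ (Fin k) → ℝ} (hw : ContDiff ℝ 1 w)
    {z : EuclideanSpace ℝ (Fin d) × EuclideanSpace ℝ (Fin k)} (hz : z.1 ≠ 0) :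
    hardyWeight μ z * |twistedEuler μ α w z|
      ≤ pairNorm (gradMu μ w z - (α * w z / grho μ z) • gradMuGrho μ z) := by
  have hρ := grho_pos μ hz
  have hn := norm_pos_iff.2 hz
  have h1 := grho_sq_mul_sq hμ hz
  have hm : 0 < ‖z.1‖ ^ μ := rpow_pos_of_pos hn _
  have hnn : 0 < grho μ z ^ μ := rpow_pos_of_pos hρ _
  set σ : EuclideanSpace ℝ (Fin d) × EuclideanSpace ℝ (Fin k) :=
    (z.1, ((1 + μ) / ‖z.1‖ ^ μ) • z.2) with hσ
  set T := gradMu μ w z - (α * w z / grho μ z) • gradMuGrho μ z with hT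
  have hσn : hardyWeight μ z * pairNorm σ = 1 := by
    have : pairNorm σ = grho μ z * grho μ z ^ μ / ‖z.1‖ ^ μ := by
      rw [pairNorm, Real.sqrt_eq_iff_mul_self_eq (by positivity) (by positivity)]
      simp only [hσ, norm_smul, mul_pow, norm_eq_abs, sq_abs]
      field_simp
      linear_combination -h1
    rw [this, hardyWeight_eq μ hz]
    field_simp
  have hg : twistedEuler μ α w z = ⟪σ.1, T.1⟫ + ⟪σ.2, T.2⟫ := by
    have hsplit : fderiv ℝ w z (z.1, (1 + μ) • z.2)
        = fderiv ℝ w z (z.1, 0) + (1 + μ) * fderiv ℝ w z (0, z.2) := by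
      rw [← smul_eq_mul, ← map_smul, ← map_add]
      simp
    rw [twistedEuler, hsplit, hT, gradMu_eq_of_differentiableAt μ (hw.differentiable (by simp) z)]
    simp only [hσ, gradMuGrho, Prod.fst_sub, Prod.snd_sub, Prod.smul_fst, Prod.smul_snd,
      inner_sub_right, real_inner_smul_left, real_inner_smul_right, real_inner_self_eq_norm_sq]
    rw [real_inner_comm, InnerProductSpace.toDual_symm_apply, real_inner_comm,
      InnerProductSpace.toDual_symm_apply]
    simp only [ContinuousLinearMap.comp_apply, ContinuousLinearMap.inl_apply,
      ContinuousLinearMap.inr_apply]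
    generalize ‖z.1‖ ^ μ = m at *
    generalize grho μ z ^ μ = n at *
    field_simp
    linear_combination (-(α * w z)) * h1
  calc hardyWeight μ z * |twistedEuler μ α w z|
      ≤ hardyWeight μ z * (pairNorm σ * pairNorm T) := by
        rw [hg]
        exact mul_le_mul_of_nonneg_left (abs_inner_add_inner_le_pairNorm_mul σ T)
          (hardyWeight_nonneg μ z)
    _ = pairNorm T := by rw [← mul_assoc, hσn, one_mul]

lemma ae_fst_ne_zero (hd : 1 ≤ d) :
    ∀ᵐ z : EuclideanSpace ℝ (Fin d) × EuclideanSpace ℝ (Fin k), z.1 ≠ 0 := by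
  have : Nontrivial (EuclideanSpace ℝ (Fin d)) :=
    Module.nontrivial_of_finrank_pos (R := ℝ) (by rw [finrank_euclideanSpace_fin]; omega)
  have h : ∀ᵐ x : EuclideanSpace ℝ (Fin d), x ≠ 0 := by simp [ae_iff]
  exact Measure.quasiMeasurePreserving_fst.ae h

/-- Weighted Hardy inequality for the twisted Grushin gradient. -/
lemma exists_lintegral_hardyWeight_le_twisted {d k : ℕ} (hd : 1 ≤ d) {μ : ℝ} (hμ : 0 < μ)
    {p α : ℝ} (hp : 1 < p) (hα : (p - (d + (1 + μ) * k)) / p < α) :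
    ∃ K : ℝ≥0∞, K ≠ ∞ ∧
      ∀ w : EuclideanSpace ℝ (Fin d) × EuclideanSpace ℝ (Fin k) → ℝ,
        ContDiff ℝ 1 w → HasCompactSupport w →
        ∫⁻ z, (ENNReal.ofReal (hardyWeight μ z) * ‖w z‖ₑ) ^ p
          ≤ K * ∫⁻ z, ENNReal.ofReal
              (pairNorm (gradMu μ w z - (α * w z / grho μ z) • gradMuGrho μ z)) ^ p := by
  obtain ⟨K, hK, hH⟩ := exists_lintegral_hardyWeight_le d k hμ hp hα
  refine ⟨K, hK, fun w hw hc => (hH w hw hc).trans (mul_le_mul_right (lintegral_mono_ae ?_) K)⟩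
  filter_upwards [ae_fst_ne_zero hd] with z hz
  refine ENNReal.rpow_le_rpow ?_ (by linarith)
  rw [enorm_eq_ofReal_abs, ← ENNReal.ofReal_mul (hardyWeight_nonneg μ z)]
  exact ENNReal.ofReal_le_ofReal (hardyWeight_mul_abs_twistedEuler_le hμ α hw hz)

lemma lintegral_rpow_le_of_le_add {Ω : Type*} [MeasurableSpace Ω] {ν : Measure Ω}
    {f g h : Ω → ℝ≥0∞} {p : ℝ} (hp : 1 ≤ p) (a : ℝ≥0∞) (hg : Measurable g)
    (hfg : ∀ᵐ z ∂ν, f z ≤ g z + a * h z) (hh : Measurable h) :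
    ∫⁻ z, f z ^ p ∂ν ≤ 2 ^ (p - 1) * (∫⁻ z, g z ^ p ∂ν + a ^ p * ∫⁻ z, h z ^ p ∂ν) := by
  have hp0 : 0 ≤ p := by linarith
  rw [← lintegral_const_mul _ (by fun_prop), ← lintegral_add_left (by fun_prop),
    ← lintegral_const_mul _ (by fun_prop)]
  refine lintegral_mono_ae ?_
  filter_upwards [hfg] with z hz
  rw [← ENNReal.mul_rpow_of_nonneg _ _ hp0]
  exact (ENNReal.rpow_le_rpow hz hp0).trans (ENNReal.rpow_add_le_mul_rpow_add_rpow _ _ hp)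

end GrushinGradient

/-- Coercivity of the twisted Grushin gradient. -/
theorem twisted_grushin_gradient_coercive
    (d k : ℕ) (hd : 1 ≤ d) (hk : 1 ≤ k) (μ : ℝ) (hμ : 0 < μ)
    (Q : ℝ) (hQ : Q = d + (1 + μ) * k)
    (p α : ℝ) (hp1 : 1 < p) (hpQ : p < Q) (hα : (p - Q) / p < α) :
    ∃ C' : ℝ, 0 < C' ∧
      ∀ w : EuclideanSpace ℝ (Fin d) × EuclideanSpace ℝ (Fin k) → ℝ,
        ContDiff ℝ (⊤ : ℕ∞) w → HasCompactSupport w →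
        C' * ∫ z, gradMuNorm μ w z ^ p
          ≤ ∫ z, pairNorm (gradMu μ w z - (α * w z / grho μ z) • gradMu μ (grho μ) z) ^ p := by
  subst hQ
  have hp0 : 0 < p := by linarith
  obtain ⟨K, hK, hKα⟩ := exists_lintegral_hardyWeight_le_twisted (k := k) hd hμ hp1 hα
  obtain ⟨K₀, hK₀, hK₀'⟩ := exists_lintegral_hardyWeight_le_twisted (k := k) hd hμ hp1
    (div_neg_of_neg_of_pos (sub_neg.2 hpQ) hp0)
  set a : ℝ≥0∞ := ENNReal.ofReal |α| with ha
  have hap : a ^ p ≠ ∞ := (ENNReal.rpow_lt_top_of_nonneg hp0.le ENNReal.ofReal_ne_top).ne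
  have h2p : (2 : ℝ≥0∞) ^ (p - 1) ≠ ∞ :=
    (ENNReal.rpow_lt_top_of_nonneg (by linarith) ENNReal.ofNat_ne_top).ne
  set L : ℝ≥0∞ := 2 ^ (p - 1) * (1 + a ^ p * K) with hL
  have hL' : L ≠ ∞ := ENNReal.mul_ne_top h2p
    (ENNReal.add_ne_top.2 ⟨ENNReal.one_ne_top, ENNReal.mul_ne_top hap hK⟩)
  refine ⟨1 / (L.toReal + 1), by positivity, fun w hw hc => ?_⟩
  have hw1 : ContDiff ℝ 1 w := hw.of_le (by norm_cast)
  set T : EuclideanSpace ℝ (Fin d) × EuclideanSpace ℝ (Fin k) → ℝ := fun z =>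
    pairNorm (gradMu μ w z - (α * w z / grho μ z) • gradMuGrho μ z) with hT
  have hTint : ∫ z, pairNorm (gradMu μ w z - (α * w z / grho μ z) • gradMu μ (grho μ) z) ^ p
      = ∫ z, T z ^ p := by
    refine integral_congr_ae ?_
    filter_upwards [ae_fst_ne_zero hd] with z hz
    rw [gradMu_grho hμ hz]
  have hNm : Measurable (gradMuNorm μ w) :=
    (continuous_pairNorm.comp (continuous_gradMu hμ hw1)).measurable
  have hTm : Measurable T := by
    have h1 := hw.continuous.measurable
    have h2 := (continuous_gradMu hμ hw1).measurable
    have h3 := measurable_grho μ (d := d) (k := k)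
    have h4 := measurable_gradMuGrho μ (d := d) (k := k)
    exact continuous_pairNorm.measurable.comp
      (h2.sub (((h1.const_mul α).div h3).smul h4))
  have hHm : Measurable fun z => ENNReal.ofReal (hardyWeight μ z) * ‖w z‖ₑ :=
    (measurable_hardyWeight μ).ennreal_ofReal.mul hw.continuous.measurable.enorm
  have hsmul : ∀ z : EuclideanSpace ℝ (Fin d) × EuclideanSpace ℝ (Fin k), z.1 ≠ 0 →
      a * (ENNReal.ofReal (hardyWeight μ z) * ‖w z‖ₑ)
        = ENNReal.ofReal (pairNorm ((α * w z / grho μ z) • gradMuGrho μ z)) := fun z hz => by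
    rw [pairNorm_smul_gradMuGrho hμ α (w z) hz, ENNReal.ofReal_mul (abs_nonneg _),
      ENNReal.ofReal_mul (hardyWeight_nonneg μ z), enorm_eq_ofReal_abs]
  have hNT : ∫⁻ z, ENNReal.ofReal (gradMuNorm μ w z) ^ p
      ≤ L * ∫⁻ z, ENNReal.ofReal (T z) ^ p := by
    refine (lintegral_rpow_le_of_le_add hp1.le a hTm.ennreal_ofReal ?_ hHm).trans ?_
    · filter_upwards [ae_fst_ne_zero hd] with z hz
      rw [hsmul z hz, ← ENNReal.ofReal_add (pairNorm_nonneg _) (pairNorm_nonneg _)]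
      exact ENNReal.ofReal_le_ofReal (pairNorm_le_pairNorm_sub_add _ _)
    · rw [hL, mul_assoc, add_mul, one_mul, mul_assoc (a ^ p)]
      gcongr
      exact hKα w hw1 hc
  have hof : ∀ f : EuclideanSpace ℝ (Fin d) × EuclideanSpace ℝ (Fin k) → ℝ, (∀ z, 0 ≤ f z) →
      ∫⁻ z, ENNReal.ofReal (f z ^ p) = ∫⁻ z, ENNReal.ofReal (f z) ^ p := fun f hf =>
    lintegral_congr fun z => (ENNReal.ofReal_rpow_of_nonneg (hf z) hp0.le).symm
  have hNfin : ∫⁻ z, ENNReal.ofReal (gradMuNorm μ w z) ^ p ≠ ∞ := by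
    rw [← hof (gradMuNorm μ w) fun z => pairNorm_nonneg _]
    exact (integrable_gradMuNorm_rpow hμ hp0 hw1 hc).lintegral_lt_top.ne
  have hTfin : ∫⁻ z, ENNReal.ofReal (T z) ^ p ≠ ∞ := by
    have hH : ∫⁻ z, (ENNReal.ofReal (hardyWeight μ z) * ‖w z‖ₑ) ^ p ≠ ∞ := by
      refine ne_top_of_le_ne_top (ENNReal.mul_ne_top hK₀ hNfin) ?_
      simpa [gradMuNorm] using hK₀' w hw1 hc
    refine ne_top_of_le_ne_top ?_
      (lintegral_rpow_le_of_le_add hp1.le a hNm.ennreal_ofReal ?_ hHm)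
    · exact ENNReal.mul_ne_top h2p (ENNReal.add_ne_top.2 ⟨hNfin, ENNReal.mul_ne_top hap hH⟩)
    · filter_upwards [ae_fst_ne_zero hd] with z hz
      rw [hsmul z hz, gradMuNorm, ← ENNReal.ofReal_add (pairNorm_nonneg _) (pairNorm_nonneg _)]
      exact ENNReal.ofReal_le_ofReal (pairNorm_sub_le _ _)
  have htoReal : ∀ f : EuclideanSpace ℝ (Fin d) × EuclideanSpace ℝ (Fin k) → ℝ, (∀ z, 0 ≤ f z) →
      Measurable f → ∫ z, f z ^ p = (∫⁻ z, ENNReal.ofReal (f z) ^ p).toReal := fun f hf hfm => by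
    rw [integral_eq_lintegral_of_nonneg_ae (Filter.Eventually.of_forall fun z =>
      rpow_nonneg (hf z) p) (hfm.pow_const p).aestronglyMeasurable, hof f hf]
  rw [hTint, htoReal (gradMuNorm μ w) (fun z => pairNorm_nonneg _) hNm, htoReal T (fun z => pairNorm_nonneg _) hTm,
    one_div, inv_mul_le_iff₀ (by positivity)]
  have h := ENNReal.toReal_mono (ENNReal.mul_ne_top hL' hTfin) hNT
  rw [ENNReal.toReal_mul] at h
  have := ENNReal.toReal_nonneg (a := ∫⁻ z, ENNReal.ofReal (T z) ^ p)
  linarith
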